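/- Accumulated primal disagreement bound: under the DQN recurrence, suppose α_max < (1−λ)/(λ³ L (1+r_α) q) and η = 1 − ρ_vx ρ_xv > 0, where ρ_xv = (√2/(1−λ)) λ² α_max (1+r_α) q, ρ_vx = (√2/(1−λ)) λ L (1+λ), ρ_xr = (√2/(1−λ)) (λ² α_max (1+r_α) q + λ r_α), ρ_vr = (√2/(1−λ)) (λ³ L α_max (1+r_α) q + λ L (1+λ r_α)), ε_x = ‖x̃^{(0)}‖₂ √(2/(1−λ²)), ε_v = ‖ṽ^{(0)}‖₂ √(2/(1−λ²)), μ_xr = (ρ_xr + ρ_xv ρ_vr)/η, and μ_xc = (ρ_xv ε_v + ε_x)/η. Then for every k ≥ 0, X^{(k)} ≤ μ_xr R^{(k)} + μ_xc, where X^{(k)} = √(∑_{l=0}^{k} ‖x̃^{(l)}‖₂²) and R^{(k)} = √(∑_{l=0}^{k} (‖(α^{(l)} z^{(l)})‾‖₂² + ‖ḡ^{(l+1)}‖₂²)). -/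

import Mathlib

open Matrix Filter Topology

/-- Spectral norm (largest singular value) of a real matrix. -/
noncomputable def specNorm {m n : ℕ} (A : Matrix (Fin m) (Fin n) ℝ) : ℝ :=
  ‖LinearMap.toContinuousLinearMap (Matrix.toEuclideanLin A)‖

/-- Row-wise mean `(1/N) 11ᵀ A` of a matrix. -/
noncomputable def rowMean {N n : ℕ} (A : Matrix (Fin N) (Fin n) ℝ) : Matrix (Fin N) (Fin n) ℝ :=
  ((1 : ℝ) / N) • (Matrix.of (fun _ _ => (1 : ℝ)) * A)

/-- The stacked-gradient matrix `g(x)` whose `i`-th row is `∇f_i(x_i)ᵀ`. -/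
noncomputable def gradMat {N n : ℕ} (f : Fin N → EuclideanSpace ℝ (Fin n) → ℝ)
    (x : Matrix (Fin N) (Fin n) ℝ) : Matrix (Fin N) (Fin n) ℝ :=
  Matrix.of fun i j =>
    WithLp.equiv 2 (Fin n → ℝ) (gradient (f i) ((WithLp.equiv 2 (Fin n → ℝ)).symm (x i))) j


section MatrixNorms

open scoped Matrix.Norms.Frobenius

lemma frobenius_norm_sq {m n : ℕ} (A : Matrix (Fin m) (Fin n) ℝ) :
    ‖A‖ ^ 2 = ∑ i, ∑ j, A i j ^ 2 := by
  have h : 0 ≤ ∑ i, ∑ j, A i j ^ 2 := by positivity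
  rw [Matrix.frobenius_norm_def, ← Real.sqrt_eq_rpow]
  simp only [Real.rpow_ofNat, Real.norm_eq_abs, sq_abs]
  exact Real.sq_sqrt h

lemma specNorm_nonneg {m n : ℕ} (A : Matrix (Fin m) (Fin n) ℝ) : 0 ≤ specNorm A :=
  norm_nonneg _

lemma sum_sq_mulVec_le {m n : ℕ} (A : Matrix (Fin m) (Fin n) ℝ) (v : Fin n → ℝ) :
    ∑ i, (A *ᵥ v) i ^ 2 ≤ specNorm A ^ 2 * ∑ j, v j ^ 2 := by
  have h := (LinearMap.toContinuousLinearMap (Matrix.toEuclideanLin A)).le_opNorm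
    (WithLp.toLp 2 v)
  have h2 := pow_le_pow_left₀ (norm_nonneg _) h 2
  rw [mul_pow, EuclideanSpace.real_norm_sq_eq, EuclideanSpace.real_norm_sq_eq] at h2
  exact h2

lemma specNorm_le_of_sum_sq {m n : ℕ} (A : Matrix (Fin m) (Fin n) ℝ) {c : ℝ} (hc : 0 ≤ c)
    (h : ∀ v : Fin n → ℝ, ∑ i, (A *ᵥ v) i ^ 2 ≤ c ^ 2 * ∑ j, v j ^ 2) : specNorm A ≤ c := by
  refine ContinuousLinearMap.opNorm_le_bound _ hc fun v => ?_
  refine le_of_sq_le_sq ?_ (by positivity)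
  rw [mul_pow, EuclideanSpace.real_norm_sq_eq, EuclideanSpace.real_norm_sq_eq]
  exact h v.ofLp

lemma specNorm_add_le {m n : ℕ} (A B : Matrix (Fin m) (Fin n) ℝ) :
    specNorm (A + B) ≤ specNorm A + specNorm B := by
  unfold specNorm
  rw [map_add, map_add]
  exact norm_add_le _ _

lemma specNorm_mul_le {l m n : ℕ} (A : Matrix (Fin l) (Fin m) ℝ) (B : Matrix (Fin m) (Fin n) ℝ) :
    specNorm (A * B) ≤ specNorm A * specNorm B := by
  refine specNorm_le_of_sum_sq _ (mul_nonneg (specNorm_nonneg A) (specNorm_nonneg B)) fun v => ?_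
  rw [← Matrix.mulVec_mulVec]
  calc _ ≤ specNorm A ^ 2 * ∑ j, (B *ᵥ v) j ^ 2 := sum_sq_mulVec_le _ _
    _ ≤ specNorm A ^ 2 * (specNorm B ^ 2 * ∑ j, v j ^ 2) := by
        gcongr
        exact sum_sq_mulVec_le _ _
    _ = _ := by ring

lemma specNorm_le_frobenius_norm {m n : ℕ} (A : Matrix (Fin m) (Fin n) ℝ) :
    specNorm A ≤ ‖A‖ := by
  refine specNorm_le_of_sum_sq _ (norm_nonneg _) fun v => ?_
  rw [frobenius_norm_sq, Finset.sum_mul]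
  exact Finset.sum_le_sum fun i _ => Finset.sum_mul_sq_le_sq_mul_sq Finset.univ (A i) v

lemma frobenius_norm_mul_le {l m n : ℕ} (A : Matrix (Fin l) (Fin m) ℝ)
    (B : Matrix (Fin m) (Fin n) ℝ) : ‖A * B‖ ≤ specNorm A * ‖B‖ := by
  refine le_of_sq_le_sq ?_ (mul_nonneg (specNorm_nonneg A) (norm_nonneg _))
  rw [mul_pow, frobenius_norm_sq, frobenius_norm_sq, Finset.sum_comm,
    Finset.sum_comm (f := fun i j => B i j ^ 2), Finset.mul_sum]
  exact Finset.sum_le_sum fun j _ => sum_sq_mulVec_le A fun i => B i j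

lemma frobenius_norm_le_sqrt_min {m n : ℕ} (A : Matrix (Fin m) (Fin n) ℝ) :
    ‖A‖ ≤ Real.sqrt (min (n : ℝ) m) * specNorm A := by
  refine le_of_sq_le_sq ?_ (mul_nonneg (Real.sqrt_nonneg _) (specNorm_nonneg A))
  rw [mul_pow, Real.sq_sqrt (by positivity), min_mul_of_nonneg _ _ (sq_nonneg _), le_min_iff]
  have hrow : ∀ i, ∑ j, A i j ^ 2 ≤ specNorm A ^ 2 := fun i => by
    have h := sum_sq_mulVec_le A (A i)
    have h1 : (A *ᵥ A i) i ^ 2 ≤ ∑ l, (A *ᵥ A i) l ^ 2 :=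
      Finset.single_le_sum (f := fun l => (A *ᵥ A i) l ^ 2) (fun l _ => sq_nonneg _)
        (Finset.mem_univ i)
    have h2 : (A *ᵥ A i) i = ∑ j, A i j ^ 2 := by
      simp [Matrix.mulVec, dotProduct, sq]
    rw [h2] at h1
    have h0 : 0 ≤ ∑ j, A i j ^ 2 := by positivity
    by_contra! hlt
    nlinarith [sq_nonneg (specNorm A)]
  have hcol : ∀ j, ∑ i, A i j ^ 2 ≤ specNorm A ^ 2 := fun j => by
    simpa [Pi.single_apply] using sum_sq_mulVec_le A (Pi.single j 1)
  constructor
  · rw [frobenius_norm_sq, Finset.sum_comm]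
    simpa using Finset.sum_le_sum fun j (_ : j ∈ Finset.univ) => hcol j
  · rw [frobenius_norm_sq]
    simpa using Finset.sum_le_sum fun i (_ : i ∈ Finset.univ) => hrow i

lemma abs_sum_mul_le_frobenius_norm {m n : ℕ} (A B : Matrix (Fin m) (Fin n) ℝ) :
    |∑ i, ∑ j, A i j * B i j| ≤ ‖A‖ * ‖B‖ := by
  refine abs_le_of_sq_le_sq ?_ (by positivity)
  rw [mul_pow, frobenius_norm_sq, frobenius_norm_sq, ← Fintype.sum_prod_type',
    ← Fintype.sum_prod_type', ← Fintype.sum_prod_type']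
  exact Finset.sum_mul_sq_le_sq_mul_sq _ _ _

lemma rowMean_eq {N n : ℕ} (A : Matrix (Fin N) (Fin n) ℝ) :
    rowMean A = ((1 : ℝ) / N) •
      ((Matrix.of fun _ _ => (1 : ℝ) : Matrix (Fin N) (Fin N) ℝ) * A : Matrix (Fin N) (Fin n) ℝ) :=
  rfl

lemma rowMean_apply {N n : ℕ} (A : Matrix (Fin N) (Fin n) ℝ) (i : Fin N) (j : Fin n) :
    rowMean A i j = (1 / N) * ∑ l, A l j := by
  rw [rowMean_eq, Matrix.smul_apply, Matrix.mul_apply]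
  simp

lemma rowMean_add {N n : ℕ} (A B : Matrix (Fin N) (Fin n) ℝ) :
    rowMean (A + B) = rowMean A + rowMean B := by
  simp [rowMean_eq, Matrix.mul_add]

lemma rowMean_sub {N n : ℕ} (A B : Matrix (Fin N) (Fin n) ℝ) :
    rowMean (A - B) = rowMean A - rowMean B := by
  simp [rowMean_eq, Matrix.mul_sub, smul_sub]

lemma rowMean_rowMean {N n : ℕ} (hN : 0 < N) (A : Matrix (Fin N) (Fin n) ℝ) :
    rowMean (rowMean A) = rowMean A := by
  ext i j
  have : (N : ℝ) ≠ 0 := by positivity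
  simp only [rowMean_apply, Finset.sum_const, Finset.card_univ, Fintype.card_fin, nsmul_eq_mul]
  field_simp

/-- The row-wise mean is self-adjoint for the entrywise inner product. -/
lemma sum_rowMean_mul {N n : ℕ} (A B : Matrix (Fin N) (Fin n) ℝ) :
    ∑ i, ∑ j, rowMean A i j * B i j = ∑ i, ∑ j, A i j * rowMean B i j := by
  simp only [rowMean_apply]
  rw [Finset.sum_comm, Finset.sum_comm (f := fun i j => A i j * _)]
  refine Finset.sum_congr rfl fun j _ => ?_
  rw [← Finset.mul_sum, ← Finset.sum_mul]
  ring

lemma frobenius_norm_sq_eq_mean_add_consensus {N n : ℕ} (hN : 0 < N)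
    (A : Matrix (Fin N) (Fin n) ℝ) :
    ‖A‖ ^ 2 = ‖rowMean A‖ ^ 2 + ‖A - rowMean A‖ ^ 2 := by
  have h := sum_rowMean_mul A (A - rowMean A)
  rw [rowMean_sub, rowMean_rowMean hN, sub_self] at h
  simp only [Matrix.zero_apply, mul_zero, Finset.sum_const_zero, Matrix.sub_apply] at h
  have h2 : ∑ i, ∑ j, A i j ^ 2 = ∑ i, ∑ j, rowMean A i j ^ 2 + ∑ i, ∑ j, (A i j - rowMean A i j) ^ 2
      + 2 * ∑ i, ∑ j, rowMean A i j * (A i j - rowMean A i j) := by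
    simp only [Finset.mul_sum, ← Finset.sum_add_distrib]
    exact Finset.sum_congr rfl fun i _ => Finset.sum_congr rfl fun j _ => by ring
  simp only [frobenius_norm_sq, Matrix.sub_apply]
  rw [h2, h]
  ring

lemma frobenius_norm_consensus_le {N n : ℕ} (hN : 0 < N) (A : Matrix (Fin N) (Fin n) ℝ) :
    ‖A - rowMean A‖ ≤ ‖A‖ :=
  le_of_sq_le_sq (by
    have h := frobenius_norm_sq_eq_mean_add_consensus hN A
    have h0 : 0 ≤ ‖rowMean A‖ ^ 2 := by positivity
    linarith) (norm_nonneg _)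

lemma frobenius_norm_rowMean_le {N n : ℕ} (hN : 0 < N) (A : Matrix (Fin N) (Fin n) ℝ) :
    ‖rowMean A‖ ≤ ‖A‖ :=
  le_of_sq_le_sq (by
    have h := frobenius_norm_sq_eq_mean_add_consensus hN A
    have h0 : 0 ≤ ‖A - rowMean A‖ ^ 2 := by positivity
    linarith) (norm_nonneg _)

/-- A matrix with equal rows has rank at most one, so its Frobenius norm is its spectral norm. -/
lemma frobenius_norm_rowMean_le_specNorm {N n : ℕ} (hN : 0 < N) (A : Matrix (Fin N) (Fin n) ℝ) :
    ‖rowMean A‖ ≤ specNorm (rowMean A) := by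
  refine le_of_sq_le_sq ?_ (specNorm_nonneg _)
  have hN' : (0 : ℝ) < N := by positivity
  set w : Fin n → ℝ := fun j => (1 / N) * ∑ l, A l j
  have hw : ∀ i j, rowMean A i j = w j := fun i j => rowMean_apply A i j
  have h := sum_sq_mulVec_le (rowMean A) w
  have h1 : ∀ i, (rowMean A *ᵥ w) i = ∑ j, w j ^ 2 := fun i => by
    simp [Matrix.mulVec, dotProduct, hw, sq]
  rw [frobenius_norm_sq]
  simp only [h1, hw, Finset.sum_const, Finset.card_univ, Fintype.card_fin, nsmul_eq_mul] at h ⊢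
  have h0 : 0 ≤ ∑ j, w j ^ 2 := by positivity
  by_contra! hlt
  nlinarith [sq_nonneg (specNorm (rowMean A))]

lemma rowMean_mul_of_vecMul_one {N n : ℕ} {W : Matrix (Fin N) (Fin N) ℝ}
    (h1W : (fun _ => (1 : ℝ)) ᵥ* W = fun _ => 1) (A : Matrix (Fin N) (Fin n) ℝ) :
    rowMean (W * A) = rowMean A := by
  have hW : ∀ i, ∑ l, W l i = 1 := fun i => by
    simpa [Matrix.vecMul, dotProduct] using congrFun h1W i
  ext i j
  rw [rowMean_apply, rowMean_apply]
  simp only [Matrix.mul_apply]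
  rw [Finset.sum_comm]
  simp [← Finset.sum_mul, hW]

lemma consensus_mul {N n : ℕ} (hN : 0 < N) {W : Matrix (Fin N) (Fin N) ℝ}
    (hW1 : W *ᵥ (fun _ => (1 : ℝ)) = fun _ => 1) (h1W : (fun _ => (1 : ℝ)) ᵥ* W = fun _ => 1)
    (A : Matrix (Fin N) (Fin n) ℝ) :
    W * A - rowMean (W * A) =
      (W - ((1 : ℝ) / N) • Matrix.of (fun _ _ => (1 : ℝ))) * (A - rowMean A) := by
  have hW : ∀ i, ∑ l, W i l = 1 := fun i => by
    simpa [Matrix.mulVec, dotProduct] using congrFun hW1 i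
  have h1 : W * rowMean A = rowMean A := by
    ext i j
    simp only [Matrix.mul_apply, rowMean_apply, ← Finset.sum_mul, hW, one_mul]
  rw [rowMean_mul_of_vecMul_one h1W, Matrix.sub_mul, Matrix.smul_mul, Matrix.mul_sub W, h1,
    ← rowMean_eq, rowMean_sub, rowMean_rowMean hN, sub_self, sub_zero]

/-- Decomposition of a step with agent-dependent step sizes `a i` into its mean and consensus
parts, in terms of the dispersion `ν` of the step sizes. -/
lemma step_dispersion_bounds {N n : ℕ} (hN : 0 < N) (a : Fin N → ℝ) (ha : ∀ i, 0 < a i)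
    {amax s : ℝ} (hmax : ∀ i, a i ≤ amax) (hs : s = (1 / (N : ℝ)) * ∑ j, a j)
    (Z : Matrix (Fin N) (Fin n) ℝ) :
    ∃ ν : ℝ, 0 ≤ ν ∧ ν ^ 2 ≤ s * (amax - s) ∧
      ‖Matrix.diagonal a * Z - rowMean (Matrix.diagonal a * Z)‖ ≤
        ν * ‖rowMean Z‖ + amax * ‖Z - rowMean Z‖ ∧
      ‖rowMean (Matrix.diagonal a * Z) - s • rowMean Z‖ ≤ ν * ‖Z - rowMean Z‖ := by
  have hN' : (0 : ℝ) < N := by positivity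
  have hsum : ∑ j, a j = N * s := by rw [hs]; field_simp
  have hdev : ∑ j, (a j - s) = 0 := by simp [Finset.sum_sub_distrib, hsum]
  have hq : ∑ j, (a j - s) ^ 2 ≤ N * (s * (amax - s)) := by
    calc ∑ j, (a j - s) ^ 2 ≤ ∑ j, (a j * (amax - s) - s * (a j - s)) :=
          Finset.sum_le_sum fun j _ => by nlinarith [ha j, hmax j]
      _ = N * (s * (amax - s)) := by
          rw [Finset.sum_sub_distrib, ← Finset.sum_mul, ← Finset.mul_sum, hdev, hsum]
          ring
  have hq0 : 0 ≤ ∑ j, (a j - s) ^ 2 := by positivity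
  have hν : Real.sqrt ((1 / N) * ∑ j, (a j - s) ^ 2) ^ 2 = (1 / N) * ∑ j, (a j - s) ^ 2 :=
    Real.sq_sqrt (by positivity)
  have hamax : 0 ≤ amax := (ha ⟨0, hN⟩).le.trans (hmax _)
  have hmean : ∀ j, ∑ l, a l * Z l j = N * s * ((1 / N) * ∑ l, Z l j) +
      ∑ l, (a l - s) * (Z l j - (1 / N) * ∑ l, Z l j) := fun j => by
    simp only [mul_sub, sub_mul, Finset.sum_sub_distrib, ← Finset.sum_mul, ← Finset.mul_sum, hsum]
    simp only [Finset.sum_const, Finset.card_univ, Fintype.card_fin, nsmul_eq_mul]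
    field_simp
    ring
  refine ⟨Real.sqrt ((1 / N) * ∑ j, (a j - s) ^ 2), Real.sqrt_nonneg _, ?_, ?_, ?_⟩
  · rw [hν, div_mul_eq_mul_div, one_mul, div_le_iff₀ hN']
    linarith
  · have hsplit : Matrix.diagonal a * Z - rowMean (Matrix.diagonal a * Z) =
        Matrix.diagonal (fun i => a i - s) * rowMean Z +
          (Matrix.diagonal a * (Z - rowMean Z) -
            rowMean (Matrix.diagonal a * (Z - rowMean Z))) := by
      ext i j
      simp only [Matrix.add_apply, Matrix.sub_apply, Matrix.diagonal_mul, rowMean_apply,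
        mul_sub, Finset.sum_sub_distrib, ← Finset.sum_mul, hsum]
      field_simp
      ring
    rw [hsplit]
    refine (norm_add_le _ _).trans (add_le_add ?_ ((frobenius_norm_consensus_le hN _).trans ?_))
    · refine le_of_sq_le_sq (le_of_eq ?_) (by positivity)
      rw [mul_pow, hν, frobenius_norm_sq, frobenius_norm_sq]
      simp only [Matrix.diagonal_mul, rowMean_apply, mul_pow (_ - s), ← Finset.mul_sum,
        ← Finset.sum_mul, Finset.sum_const, Finset.card_univ, Fintype.card_fin, nsmul_eq_mul]
      field_simp
    · refine le_of_sq_le_sq ?_ (by positivity)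
      rw [mul_pow, frobenius_norm_sq, frobenius_norm_sq, Finset.mul_sum]
      refine Finset.sum_le_sum fun i _ => ?_
      rw [Finset.mul_sum]
      refine Finset.sum_le_sum fun j _ => ?_
      rw [Matrix.diagonal_mul, mul_pow]
      have := hmax i
      have := (ha i).le
      gcongr
  · refine le_of_sq_le_sq ?_ (by positivity)
    have hent : ∀ i j, (rowMean (Matrix.diagonal a * Z) - s • rowMean Z) i j =
        (1 / N) * ∑ l, (a l - s) * (Z - rowMean Z) l j := fun i j => by
      simp only [Matrix.sub_apply, Matrix.smul_apply, rowMean_apply, Matrix.diagonal_mul,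
        smul_eq_mul, hmean]
      field_simp
      ring
    rw [mul_pow, hν, frobenius_norm_sq, frobenius_norm_sq,
      Finset.sum_comm (f := fun i j => (Z - rowMean Z) i j ^ 2)]
    simp only [hent, Finset.sum_const, Finset.card_univ, Fintype.card_fin, nsmul_eq_mul]
    rw [Finset.mul_sum, Finset.mul_sum]
    refine Finset.sum_le_sum fun j _ => ?_
    have h := Finset.sum_mul_sq_le_sq_mul_sq Finset.univ (fun l => a l - s)
      fun l => (Z - rowMean Z) l j
    rw [mul_pow, ← mul_assoc, show (N : ℝ) * (1 / N) ^ 2 = 1 / N by field_simp, mul_assoc]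
    gcongr

lemma sum_sq_mulVec_le_mul_quadraticForm {n : ℕ} {C : Matrix (Fin n) (Fin n) ℝ} {γ : ℝ}
    (hγ : 0 < γ) (hsymm : C.IsSymm) (hpos : C.PosDef) (hC : specNorm C ≤ γ) (v : Fin n → ℝ) :
    ∑ j, (C *ᵥ v) j ^ 2 ≤ γ * ∑ j, v j * (C *ᵥ v) j := by
  set w := C *ᵥ v with hw
  have h1 := hpos.posSemidef.dotProduct_mulVec_nonneg (γ • v - w)
  have hwv : v ⬝ᵥ C *ᵥ w = w ⬝ᵥ w := by
    rw [Matrix.dotProduct_mulVec, ← Matrix.mulVec_transpose, hsymm.eq, ← hw]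
  have hww : w ⬝ᵥ C *ᵥ w ≤ γ * (w ⬝ᵥ w) := by
    have h2 := sum_sq_mulVec_le C w
    have h3 := Finset.sum_mul_sq_le_sq_mul_sq Finset.univ w (C *ᵥ w)
    have h0 : 0 ≤ ∑ j, w j ^ 2 := by positivity
    have hsq : specNorm C ^ 2 ≤ γ ^ 2 := pow_le_pow_left₀ (specNorm_nonneg C) hC 2
    have hdot : w ⬝ᵥ w = ∑ j, w j ^ 2 := by simp [dotProduct, sq]
    rw [hdot]
    refine le_of_sq_le_sq (h3.trans ?_) (by positivity)
    calc (∑ j, w j ^ 2) * ∑ j, (C *ᵥ w) j ^ 2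
        ≤ (∑ j, w j ^ 2) * (γ ^ 2 * ∑ j, w j ^ 2) := by
          gcongr
          exact h2.trans (by gcongr)
      _ = _ := by ring
  simp only [star_trivial, Matrix.mulVec_sub, Matrix.mulVec_smul, sub_dotProduct, dotProduct_sub,
    smul_dotProduct, dotProduct_smul, smul_eq_mul, ← hw, hwv] at h1
  have e1 : ∑ j, w j ^ 2 = w ⬝ᵥ w := by simp [dotProduct, sq]
  have e2 : ∑ j, v j * w j = v ⬝ᵥ w := rfl
  rw [e1, e2]
  nlinarith

lemma direction_norm_le {N n : ℕ} {C : Fin N → Matrix (Fin n) (Fin n) ℝ} {γ : ℝ} (hγ : 0 < γ)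
    (hC : ∀ i, specNorm (C i) ≤ γ) {V D : Matrix (Fin N) (Fin n) ℝ}
    (hD : ∀ i, D i = -(C i *ᵥ V i)) : ‖D‖ ≤ γ * ‖V‖ := by
  refine le_of_sq_le_sq ?_ (by positivity)
  rw [mul_pow, frobenius_norm_sq, frobenius_norm_sq, Finset.mul_sum]
  refine Finset.sum_le_sum fun i _ => ?_
  simp only [hD, Pi.neg_apply, neg_sq]
  refine (sum_sq_mulVec_le _ _).trans ?_
  have := specNorm_nonneg (C i)
  have := hC i
  gcongr

lemma direction_norm_sq_le {N n : ℕ} {C : Fin N → Matrix (Fin n) (Fin n) ℝ} {γ : ℝ} (hγ : 0 < γ)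
    (hsymm : ∀ i, (C i).IsSymm) (hpos : ∀ i, (C i).PosDef)
    (hC : ∀ i, specNorm (C i) ≤ γ) {V D : Matrix (Fin N) (Fin n) ℝ}
    (hD : ∀ i, D i = -(C i *ᵥ V i)) : ‖D‖ ^ 2 ≤ γ * -∑ i, ∑ j, V i j * D i j := by
  rw [frobenius_norm_sq, ← Finset.sum_neg_distrib, Finset.mul_sum]
  refine Finset.sum_le_sum fun i _ => ?_
  simp only [hD, Pi.neg_apply, neg_sq, mul_neg, Finset.sum_neg_distrib, neg_neg]
  exact sum_sq_mulVec_le_mul_quadraticForm hγ (hsymm i) (hpos i) (hC i) _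

lemma gradMat_lipschitz {N n : ℕ} {f : Fin N → EuclideanSpace ℝ (Fin n) → ℝ} {L : ℝ} (hL0 : 0 ≤ L)
    (hL : ∀ i (u w : EuclideanSpace ℝ (Fin n)),
      ‖gradient (f i) u - gradient (f i) w‖ ≤ L * ‖u - w‖)
    (x y : Matrix (Fin N) (Fin n) ℝ) : ‖gradMat f x - gradMat f y‖ ≤ L * ‖x - y‖ := by
  refine le_of_sq_le_sq ?_ (by positivity)
  rw [mul_pow, frobenius_norm_sq, frobenius_norm_sq, Finset.mul_sum]
  refine Finset.sum_le_sum fun i _ => ?_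
  have h := pow_le_pow_left₀ (norm_nonneg _) (hL i (WithLp.toLp 2 (x i)) (WithLp.toLp 2 (y i))) 2
  rw [mul_pow, EuclideanSpace.real_norm_sq_eq, EuclideanSpace.real_norm_sq_eq] at h
  exact h

/-- A scalar bound on the weighted step dispersion. -/
lemma dispersion_le {a r s ν M U ζ y : ℝ} (hs : 0 < s) (har : a ≤ r * s)
    (hr : 1 ≤ r) (hν0 : 0 ≤ ν) (hν : ν ^ 2 ≤ s * (a - s)) (hζ : 0 ≤ ζ) (hU : 0 ≤ U)
    (hM : s * M ≤ U + ν * ζ) (hy : y ≤ ν * M + a * ζ) :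
    ν ≤ s * Real.sqrt (r - 1) ∧ y ≤ Real.sqrt (r - 1) * U + (2 - 1 / r) * a * ζ := by
  have hr0 : 0 < r := by linarith
  have hw0 := Real.sqrt_nonneg (r - 1)
  have hw := Real.sq_sqrt (show 0 ≤ r - 1 by linarith)
  set w := Real.sqrt (r - 1)
  have hνw : ν ≤ s * w := le_of_sq_le_sq (by rw [mul_pow, hw]; nlinarith) (by positivity)
  refine ⟨hνw, ?_⟩
  have h1 : s * (ν * M) ≤ s * (w * U + (a - s) * ζ) := by
    have h2 : ν * U ≤ s * w * U := by gcongr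
    have h3 : ν ^ 2 * ζ ≤ s * (a - s) * ζ := by gcongr
    nlinarith [mul_le_mul_of_nonneg_left hM hν0]
  have h2 := le_of_mul_le_mul_left h1 hs
  have h3 : 1 / r * a ≤ s := by rw [one_div, inv_mul_le_iff₀ hr0]; exact har
  nlinarith [mul_le_mul_of_nonneg_right h3 hζ]

lemma two_sub_inv_mul_sqrt_le {r : ℝ} (hr : 1 ≤ r) :
    (2 - 1 / r) * Real.sqrt (r - 1) ≤ 5 / 8 * (1 + r) := by
  have hw0 := Real.sqrt_nonneg (r - 1)
  have hw := Real.sq_sqrt (show 0 ≤ r - 1 by linarith)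
  generalize Real.sqrt (r - 1) = w at *
  obtain rfl : r = w ^ 2 + 1 := by linarith
  have h : (2 - 1 / (w ^ 2 + 1)) * w = (2 * w ^ 2 + 1) * w / (w ^ 2 + 1) := by
    field_simp
    ring
  rw [h, div_le_iff₀ (by positivity)]
  nlinarith [sq_nonneg (w ^ 2 - 8 / 5 * w), sq_nonneg (w - 20 / 11)]

lemma two_sub_inv_sq_le {r : ℝ} (hr : 1 ≤ r) : (2 - 1 / r) ^ 2 ≤ 3 / 4 * (1 + r) := by
  have hr0 : 0 < r := by linarith
  have h : (2 - 1 / r) ^ 2 = (2 * r - 1) ^ 2 / r ^ 2 := by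
    field_simp
  rw [h, div_le_iff₀ (by positivity)]
  nlinarith [mul_nonneg (sq_nonneg (r - 2)) (show 0 ≤ r - 1 / 3 by linarith)]

lemma two_sub_inv_le {r : ℝ} (hr : 1 ≤ r) : 0 ≤ 2 - 1 / r ∧ 2 - 1 / r ≤ 1 + r := by
  have h0 : 0 < 1 / r := by positivity
  have h1 : 1 / r ≤ 1 := by rw [div_le_one (by linarith)]; exact hr
  constructor <;> linarith

lemma sqrt_sub_one_le {r : ℝ} (hr : 1 ≤ r) : Real.sqrt (r - 1) ≤ r / 2 := by
  rw [Real.sqrt_le_left (by linarith)]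
  nlinarith [sq_nonneg (r - 2)]

/-- The contracted dispersion of the step in terms of the norms of the tracking variables. -/
lemma contracted_dispersion_le {lam a r γ d h G U y : ℝ} (hlam : 0 ≤ lam) (ha : 0 ≤ a)
    (hr : 1 ≤ r) (hU : 0 ≤ U)
    (hd0 : 0 ≤ d) (hd : d ≤ γ * (h + G))
    (hy : y ≤ Real.sqrt (r - 1) * U + (2 - 1 / r) * a * (lam * d)) :
    lam * y ≤ lam ^ 2 * a * (1 + r) * γ * (h + G) + lam * r * U := by
  obtain ⟨hκ0, hκ⟩ := two_sub_inv_le hr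
  have hw := sqrt_sub_one_le hr
  calc lam * y ≤ lam * (r * U + (1 + r) * a * (lam * (γ * (h + G)))) := by
        refine mul_le_mul_of_nonneg_left (hy.trans ?_) hlam
        gcongr
        linarith
    _ = _ := by ring

/-- A sharper form of `contracted_dispersion_le` that uses positive definiteness of the scaling. -/
lemma contracted_dispersion_le_of_sq_le {lam a r s γ d h G U y : ℝ} (hlam : 0 ≤ lam)
    (ha : 0 ≤ a) (hs : 0 < s) (har : a ≤ r * s) (hr : 1 ≤ r) (hγ : 0 < γ)
    (hU : 0 ≤ U) (hh : 0 ≤ h) (hG : 0 ≤ G)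
    (hd : s * d ^ 2 ≤ γ * (s * (h * d) + G * (U + s * Real.sqrt (r - 1) * (lam * d))))
    (hy : y ≤ Real.sqrt (r - 1) * U + (2 - 1 / r) * a * (lam * d)) :
    lam * y ≤ 9 / 8 * (lam * r * U) + lam ^ 2 * a * (1 + r) * γ * h +
      37 / 40 * (lam * (lam ^ 2 * a * (1 + r) * γ) * G) := by
  obtain ⟨hκ0, hκ⟩ := two_sub_inv_le hr
  have hw := sqrt_sub_one_le hr
  have hw0 := Real.sqrt_nonneg (r - 1)
  have hκw := two_sub_inv_mul_sqrt_le hr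
  have hκ2 := two_sub_inv_sq_le hr
  set w := Real.sqrt (r - 1)
  set κ := 2 - 1 / r
  have ht0 := Real.sqrt_nonneg (γ * G * U / s)
  have ht := Real.sq_sqrt (show 0 ≤ γ * G * U / s by positivity)
  set t := Real.sqrt (γ * G * U / s)
  have hst : s * t ^ 2 = γ * G * U := by rw [ht]; field_simp
  have hA : 0 ≤ γ * (h + lam * w * G) := by positivity
  have hd1 : d ^ 2 ≤ γ * (h + lam * w * G) * d + t ^ 2 := by
    refine le_of_mul_le_mul_left (a := s) ?_ hs
    rw [mul_add, hst]
    linarith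
  have hd2 : d ≤ γ * (h + lam * w * G) + t := by
    by_contra! hc
    nlinarith
  have hr0 : 0 ≤ r := by linarith
  have hcross : κ * lam ^ 2 * a * t ≤
      3 / 10 * (lam * (lam ^ 2 * a * (1 + r) * γ) * G) + 5 / 8 * (lam * r * U) := by
    refine le_of_sq_le_sq ?_ (by positivity)
    have hat : a * t ^ 2 ≤ r * (γ * G * U) := by
      rw [← hst, ← mul_assoc]
      gcongr
    calc (κ * lam ^ 2 * a * t) ^ 2 = κ ^ 2 * (lam ^ 4 * a * (a * t ^ 2)) := by ring
      _ ≤ 3 / 4 * (1 + r) * (lam ^ 4 * a * (r * (γ * G * U))) := by gcongr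
      _ = 3 / 4 * ((lam * (lam ^ 2 * a * (1 + r) * γ) * G) * (lam * r * U)) := by ring
      _ ≤ _ := by
        nlinarith [sq_nonneg (3 / 10 * (lam * (lam ^ 2 * a * (1 + r) * γ) * G) -
          5 / 8 * (lam * r * U))]
  calc lam * y ≤ lam * (w * U + κ * a * (lam * (γ * (h + lam * w * G) + t))) := by
        refine mul_le_mul_of_nonneg_left (hy.trans ?_) hlam
        gcongr
    _ = lam * w * U + κ * (lam ^ 2 * a * γ * h) + (κ * w) * (lam ^ 3 * a * γ * G) +
          κ * lam ^ 2 * a * t := by ring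
    _ ≤ lam * (r / 2) * U + (1 + r) * (lam ^ 2 * a * γ * h) +
          (5 / 8 * (1 + r)) * (lam ^ 3 * a * γ * G) +
          (3 / 10 * (lam * (lam ^ 2 * a * (1 + r) * γ) * G) + 5 / 8 * (lam * r * U)) := by
        gcongr
    _ = _ := by ring

/-- Bounds on the contracted dispersion `lam * ‖αz - mean(αz)‖` of one DQN step. -/
lemma dqn_step_dispersion_bounds {N n : ℕ} (hN : 0 < N) {W : Matrix (Fin N) (Fin N) ℝ}
    (hW1 : W *ᵥ (fun _ => (1 : ℝ)) = fun _ => 1) (h1W : (fun _ => (1 : ℝ)) ᵥ* W = fun _ => 1)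
    {lam γ amax r : ℝ}
    (hlam : lam = specNorm (W - ((1 : ℝ) / N) • Matrix.of (fun _ _ => (1 : ℝ))))
    (hγ : 0 < γ) {C : Fin N → Matrix (Fin n) (Fin n) ℝ}
    (hsymm : ∀ i, (C i).IsSymm) (hpos : ∀ i, (C i).PosDef) (hC : ∀ i, specNorm (C i) ≤ γ)
    {a : Fin N → ℝ} (ha : ∀ i, 0 < a i) (hmax : ∀ i, a i ≤ amax)
    (hr : 1 ≤ r) (har : amax ≤ r * ((1 / (N : ℝ)) * ∑ j, a j))
    {V D Z : Matrix (Fin N) (Fin n) ℝ} (hD : ∀ i, D i = -(C i *ᵥ V i)) (hZ : Z = W * D) :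
    lam * ‖Matrix.diagonal a * Z - rowMean (Matrix.diagonal a * Z)‖ ≤
        lam ^ 2 * amax * (1 + r) * γ * (‖V - rowMean V‖ + ‖rowMean V‖) +
          lam * r * ‖rowMean (Matrix.diagonal a * Z)‖ ∧
      lam * ‖Matrix.diagonal a * Z - rowMean (Matrix.diagonal a * Z)‖ ≤
        9 / 8 * (lam * r * ‖rowMean (Matrix.diagonal a * Z)‖) +
          lam ^ 2 * amax * (1 + r) * γ * ‖V - rowMean V‖ +
          37 / 40 * (lam * (lam ^ 2 * amax * (1 + r) * γ) * ‖rowMean V‖) := by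
  have hlam0 : 0 ≤ lam := hlam ▸ specNorm_nonneg _
  have hamax : 0 ≤ amax := (ha ⟨0, hN⟩).le.trans (hmax _)
  obtain ⟨s, hs⟩ : ∃ s, s = (1 / (N : ℝ)) * ∑ j, a j := ⟨_, rfl⟩
  rw [← hs] at har
  have hs0 : 0 < s := by
    have : Nonempty (Fin N) := ⟨⟨0, hN⟩⟩
    have := Finset.sum_pos (fun j _ => ha j) (Finset.univ_nonempty (α := Fin N))
    rw [hs]
    positivity
  obtain ⟨ν, hν0, hν, hy, hB⟩ := step_dispersion_bounds hN a ha hmax hs Z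
  set Y := Matrix.diagonal a * Z
  have hMean : rowMean Z = rowMean D := by rw [hZ, rowMean_mul_of_vecMul_one h1W]
  have hζ : ‖Z - rowMean Z‖ ≤ lam * ‖D‖ := by
    rw [hZ, consensus_mul hN hW1 h1W, hlam]
    refine (frobenius_norm_mul_le _ _).trans ?_
    exact mul_le_mul_of_nonneg_left (frobenius_norm_consensus_le hN D) (specNorm_nonneg _)
  have hM : s * ‖rowMean Z‖ ≤ ‖rowMean Y‖ + ν * ‖Z - rowMean Z‖ := by
    have h := norm_sub_le (rowMean Y) (rowMean Y - s • rowMean Z)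
    rw [sub_sub_cancel, norm_smul, Real.norm_of_nonneg hs0.le] at h
    linarith
  obtain ⟨hνs, hyU⟩ := dispersion_le hs0 har hr hν0 hν (norm_nonneg (Z - rowMean Z))
    (norm_nonneg (rowMean Y)) hM hy
  have hκ := (two_sub_inv_le hr).1
  have hyd : ‖Y - rowMean Y‖ ≤
      Real.sqrt (r - 1) * ‖rowMean Y‖ + (2 - 1 / r) * amax * (lam * ‖D‖) :=
    hyU.trans (by gcongr)
  refine ⟨contracted_dispersion_le hlam0 hamax hr (norm_nonneg _) (norm_nonneg D) ?_ hyd,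
    contracted_dispersion_le_of_sq_le hlam0 hamax hs0 har hr hγ (norm_nonneg _) (norm_nonneg _)
      (norm_nonneg _) ?_ hyd⟩
  · refine (direction_norm_le hγ hC hD).trans (mul_le_mul_of_nonneg_left ?_ hγ.le)
    simpa using norm_add_le (V - rowMean V) (rowMean V)
  · have h1 := direction_norm_sq_le hγ hsymm hpos hC hD
    have h2 : ∑ i, ∑ j, V i j * D i j =
        ∑ i, ∑ j, (V - rowMean V) i j * D i j + ∑ i, ∑ j, rowMean V i j * rowMean Z i j := by
      rw [hMean, ← sum_rowMean_mul (rowMean V), rowMean_rowMean hN, ← Finset.sum_add_distrib]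
      refine Finset.sum_congr rfl fun i _ => ?_
      rw [← Finset.sum_add_distrib]
      refine Finset.sum_congr rfl fun j _ => ?_
      rw [Matrix.sub_apply]
      ring
    have h3 := (abs_le.1 (abs_sum_mul_le_frobenius_norm (V - rowMean V) D)).1
    have h4 := (abs_le.1 (abs_sum_mul_le_frobenius_norm (rowMean V) (rowMean Z))).1
    have h5 : s * ‖rowMean Z‖ ≤ ‖rowMean Y‖ + s * Real.sqrt (r - 1) * (lam * ‖D‖) :=
      hM.trans (by gcongr)
    calc s * ‖D‖ ^ 2 ≤ s * (γ * (‖V - rowMean V‖ * ‖D‖ + ‖rowMean V‖ * ‖rowMean Z‖)) := by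
          refine mul_le_mul_of_nonneg_left (h1.trans ?_) hs0.le
          refine mul_le_mul_of_nonneg_left ?_ hγ.le
          linarith
      _ = γ * (s * (‖V - rowMean V‖ * ‖D‖) + ‖rowMean V‖ * (s * ‖rowMean Z‖)) := by ring
      _ ≤ _ := by gcongr

/-- The Euclidean norm of the first `k` terms of a real sequence. -/
noncomputable def l2Norm (k : ℕ) (a : ℕ → ℝ) : ℝ :=
  Real.sqrt (∑ l ∈ Finset.range k, a l ^ 2)

lemma l2Norm_nonneg (k : ℕ) (a : ℕ → ℝ) : 0 ≤ l2Norm k a :=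
  Real.sqrt_nonneg _

lemma l2Norm_sq (k : ℕ) (a : ℕ → ℝ) : l2Norm k a ^ 2 = ∑ l ∈ Finset.range k, a l ^ 2 :=
  Real.sq_sqrt (by positivity)

lemma l2Norm_mono {k : ℕ} {a b : ℕ → ℝ} (ha : ∀ l, 0 ≤ a l) (hab : ∀ l, a l ≤ b l) :
    l2Norm k a ≤ l2Norm k b :=
  Real.sqrt_le_sqrt <| Finset.sum_le_sum fun l _ => pow_le_pow_left₀ (ha l) (hab l) 2

lemma l2Norm_add_le (k : ℕ) (a b : ℕ → ℝ) :
    l2Norm k (fun l => a l + b l) ≤ l2Norm k a + l2Norm k b := by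
  refine le_of_sq_le_sq ?_ (add_nonneg (l2Norm_nonneg _ _) (l2Norm_nonneg _ _))
  have h : ∑ l ∈ Finset.range k, a l * b l ≤ l2Norm k a * l2Norm k b :=
    Real.sum_mul_le_sqrt_mul_sqrt _ _ _
  rw [add_sq, l2Norm_sq, l2Norm_sq, l2Norm_sq]
  simp only [add_sq, Finset.sum_add_distrib, mul_assoc, ← Finset.mul_sum]
  linarith

lemma l2Norm_const_mul (k : ℕ) {c : ℝ} (hc : 0 ≤ c) (a : ℕ → ℝ) :
    l2Norm k (fun l => c * a l) = c * l2Norm k a := by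
  unfold l2Norm
  simp only [mul_pow, ← Finset.mul_sum]
  rw [Real.sqrt_mul (sq_nonneg c), Real.sqrt_sq hc]

lemma l2Norm_le_succ (k : ℕ) (a : ℕ → ℝ) : l2Norm k a ≤ l2Norm (k + 1) a := by
  refine Real.sqrt_le_sqrt ?_
  rw [Finset.sum_range_succ]
  linarith [sq_nonneg (a k)]

lemma l2Norm_succ_sq (k : ℕ) (a : ℕ → ℝ) :
    l2Norm (k + 1) a ^ 2 = l2Norm k (fun l => a (l + 1)) ^ 2 + a 0 ^ 2 := by
  rw [l2Norm_sq, l2Norm_sq, Finset.sum_range_succ']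

lemma l2Norm_geometric_le (k : ℕ) {lam c : ℝ} (hlam0 : 0 ≤ lam) (hlam1 : lam < 1) (hc : 0 ≤ c) :
    l2Norm k (fun l => lam ^ l * c) ≤ c / Real.sqrt (1 - lam ^ 2) := by
  have h1 : 0 < 1 - lam ^ 2 := by nlinarith
  refine le_of_sq_le_sq ?_ (by positivity)
  rw [l2Norm_sq, div_pow, Real.sq_sqrt h1.le, le_div_iff₀ h1]
  have h2 := mul_neg_geom_sum (lam ^ 2) k
  have h3 : ∑ l ∈ Finset.range k, (lam ^ l * c) ^ 2 =
      (∑ l ∈ Finset.range k, (lam ^ 2) ^ l) * c ^ 2 := by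
    rw [Finset.sum_mul]
    exact Finset.sum_congr rfl fun l _ => by ring
  rw [h3]
  nlinarith [pow_nonneg (sq_nonneg lam) k, sq_nonneg c,
    mul_nonneg (pow_nonneg (sq_nonneg lam) k) (sq_nonneg c)]

/-- The solution of `c (l + 1) = lam * c l + w l` with `c 0 = 0`. -/
def linRec (lam : ℝ) (w : ℕ → ℝ) : ℕ → ℝ
  | 0 => 0
  | l + 1 => lam * linRec lam w l + w l

lemma linRec_nonneg {lam : ℝ} (hlam : 0 ≤ lam) {w : ℕ → ℝ} (hw : ∀ l, 0 ≤ w l) (l : ℕ) :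
    0 ≤ linRec lam w l := by
  induction l with
  | zero => exact le_rfl
  | succ l ih => exact add_nonneg (mul_nonneg hlam ih) (hw l)

lemma linRec_add (lam : ℝ) (w₁ w₂ : ℕ → ℝ) (l : ℕ) :
    linRec lam (fun l => w₁ l + w₂ l) l = linRec lam w₁ l + linRec lam w₂ l := by
  induction l with
  | zero => simp [linRec]
  | succ l ih => simp only [linRec, ih]; ring

lemma le_geometric_add_linRec {lam : ℝ} (hlam : 0 ≤ lam) {a w : ℕ → ℝ}
    (h : ∀ l, a (l + 1) ≤ lam * a l + w l) (l : ℕ) : a l ≤ lam ^ l * a 0 + linRec lam w l := by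
  induction l with
  | zero => simp [linRec]
  | succ l ih =>
    calc a (l + 1) ≤ lam * a l + w l := h l
      _ ≤ lam * (lam ^ l * a 0 + linRec lam w l) + w l := by gcongr
      _ = _ := by rw [linRec]; ring

lemma l2Norm_linRec_le {lam : ℝ} (hlam0 : 0 ≤ lam) (hlam1 : lam < 1) (w : ℕ → ℝ) (k : ℕ) :
    l2Norm (k + 1) (linRec lam w) ≤ l2Norm k w / (1 - lam) := by
  have h1 : l2Norm (k + 1) (linRec lam w) = l2Norm k fun l => linRec lam w (l + 1) := by
    rw [l2Norm, Finset.sum_range_succ']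
    simp [l2Norm, linRec]
  have h2 : l2Norm k (fun l => linRec lam w (l + 1)) ≤
      lam * l2Norm k (linRec lam w) + l2Norm k w := by
    rw [← l2Norm_const_mul k hlam0]
    exact l2Norm_add_le k (fun l => lam * linRec lam w l) w
  have h3 := mul_le_mul_of_nonneg_left (l2Norm_le_succ k (linRec lam w)) hlam0
  rw [le_div_iff₀ (by linarith)]
  linarith

lemma l2Norm_le_of_contraction {lam : ℝ} (hlam0 : 0 ≤ lam) (hlam1 : lam < 1) {a w : ℕ → ℝ}
    (ha : ∀ l, 0 ≤ a l) (h : ∀ l, a (l + 1) ≤ lam * a l + w l) (k : ℕ) :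
    l2Norm (k + 1) a ≤ a 0 / Real.sqrt (1 - lam ^ 2) + l2Norm k w / (1 - lam) :=
  calc l2Norm (k + 1) a ≤ l2Norm (k + 1) fun l => lam ^ l * a 0 + linRec lam w l :=
        l2Norm_mono ha (le_geometric_add_linRec hlam0 h)
    _ ≤ _ := (l2Norm_add_le _ _ _).trans
        (add_le_add (l2Norm_geometric_le _ hlam0 hlam1 (ha 0)) (l2Norm_linRec_le hlam0 hlam1 w k))

set_option maxHeartbeats 800000 in
/-- Accumulated bound on the forcing term `φ` of the consensus recursion. -/
lemma l2Norm_forcing_le {lam L S r p b H R : ℝ} (hlam0 : 0 ≤ lam) (hlam1 : lam < 1) (hL : 0 ≤ L)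
    (hS : 0 ≤ S) (hr : 0 ≤ r) (hp : p = lam * L * S / (1 - lam)) (hb : b = 37 / 40 * (lam * L * S))
    (hP : lam * L * S ≤ (1 - lam) / 2)
    {e h U G φ : ℕ → ℝ} (he0 : ∀ l, 0 ≤ e l) (hh0 : ∀ l, 0 ≤ h l) (hU0 : ∀ l, 0 ≤ U l)
    (hG0 : ∀ l, 0 ≤ G l) (hφ0 : ∀ l, 0 ≤ φ l)
    (hh : ∀ l, h (l + 1) ≤ lam * h l + lam * L * ((1 + lam) * e l + φ l + U l))
    (hφ : ∀ l, φ l ≤ S * (h l + G l) + lam * r * U l)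
    (hφi : φ 0 ≤ 9 / 8 * (lam * r * U 0) + S * h 0 + 37 / 40 * (lam * S * G 0))
    (hGi : G 0 ≤ G 1 + L * ((1 + lam) * e 0 + φ 0 + U 0)) (k : ℕ)
    (hH : H = h 0 / Real.sqrt (1 - lam ^ 2)) (hR0 : 0 ≤ R)
    (hUR : l2Norm (k + 1) U ≤ R) (hGR : l2Norm (k + 1) (fun l => G (l + 1)) ≤ R) :
    l2Norm (k + 1) φ ≤ S / (1 - b) * H + Real.sqrt 2 * S * R + lam * r * (9 / 8 / (1 - b)) * R +
      2 * p * R + b / (1 - b) * ((1 + lam) * e 0) +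
      p * ((1 + lam) * l2Norm (k + 1) e + l2Norm (k + 1) φ) := by
  have hμ : 0 < 1 - lam := by linarith
  have hP0 : 0 ≤ lam * L * S := by positivity
  have hb0 : 0 ≤ b := by rw [hb]; positivity
  have hb1 : 0 < 1 - b := by rw [hb]; linarith
  have hp0 : 0 ≤ p := by rw [hp]; positivity
  have hPp : lam * L * S ≤ p := by
    rw [hp, le_div_iff₀ hμ]
    nlinarith
  set c₁ := linRec lam fun l => lam * L * ((1 + lam) * e l + φ l)
  set c₂ := linRec lam fun l => lam * L * U l
  have hc₁ : ∀ l, 0 ≤ c₁ l := linRec_nonneg hlam0 fun l => by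
    have := he0 l; have := hφ0 l; positivity
  have hc₂ : ∀ l, 0 ≤ c₂ l := linRec_nonneg hlam0 fun l => by
    have := hU0 l; positivity
  have hhl : ∀ l, h l ≤ lam ^ l * h 0 + (c₁ l + c₂ l) := fun l => by
    rw [← linRec_add]
    exact le_geometric_add_linRec hlam0 (fun l => (hh l).trans_eq (by ring)) l
  set T₁ : ℕ → ℝ := fun l => S / (1 - b) * (lam ^ l * h 0)
  set T₂ : ℕ → ℝ := fun l => S * G (max l 1)
  set T₃ : ℕ → ℝ := fun l => lam * r * (9 / 8 / (1 - b)) * U l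
  set T₄ : ℕ → ℝ := fun l => if l = 0 then b / (1 - b) * U 0 else S * c₂ l
  set T₅ : ℕ → ℝ := fun l => if l = 0 then b / (1 - b) * ((1 + lam) * e 0) else 0
  set T₆ : ℕ → ℝ := fun l => S * c₁ l
  have hpt : ∀ l, φ l ≤ T₁ l + T₂ l + T₃ l + T₄ l + T₅ l + T₆ l := by
    intro l
    rcases l with _ | l
    · have h1 : φ 0 * (1 - b) ≤ 9 / 8 * (lam * r * U 0) + S * h 0 + 37 / 40 * (lam * S) * G 1 +
          b * ((1 + lam) * e 0) + b * U 0 := by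
        have h2 := mul_le_mul_of_nonneg_left hGi (show 0 ≤ 37 / 40 * (lam * S) by positivity)
        rw [hb]
        linarith
      have h2 : 37 / 40 * (lam * S) * G 1 ≤ (1 - b) * (S * G 1) := by
        have h3 : 0 ≤ S * G 1 := mul_nonneg hS (hG0 1)
        have h4 : 37 / 40 * lam ≤ 1 - b := by rw [hb]; linarith
        nlinarith
      have h3 : (1 - b) * (T₁ 0 + T₂ 0 + T₃ 0 + T₄ 0 + T₅ 0) = 9 / 8 * (lam * r * U 0) + S * h 0 +
          (1 - b) * (S * G 1) + b * ((1 + lam) * e 0) + b * U 0 := by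
        simp only [T₁, T₂, T₃, T₄, T₅, if_true, pow_zero, Nat.zero_max]
        field_simp
        ring
      have h4 : φ 0 ≤ T₁ 0 + T₂ 0 + T₃ 0 + T₄ 0 + T₅ 0 :=
        le_of_mul_le_mul_left (by linarith) hb1
      exact h4.trans (le_add_of_nonneg_right (mul_nonneg hS (hc₁ 0)))
    · have h1 : S ≤ S / (1 - b) := le_div_self hS hb1 (by linarith)
      have h2 : (1 : ℝ) ≤ 9 / 8 / (1 - b) := by rw [le_div_iff₀ hb1]; linarith
      have h3 : S * (lam ^ (l + 1) * h 0) ≤ S / (1 - b) * (lam ^ (l + 1) * h 0) :=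
        mul_le_mul_of_nonneg_right h1 (mul_nonneg (pow_nonneg hlam0 _) (hh0 0))
      have h4 : lam * r * U (l + 1) ≤ lam * r * (9 / 8 / (1 - b)) * U (l + 1) :=
        mul_le_mul_of_nonneg_right (le_mul_of_one_le_right (by positivity) h2) (hU0 _)
      have h5 := mul_le_mul_of_nonneg_left (hhl (l + 1)) hS
      have h6 := hφ (l + 1)
      have h7 : max (l + 1) 1 = l + 1 := by omega
      simp only [T₁, T₂, T₃, T₄, T₅, T₆, h7, Nat.add_eq_zero_iff, one_ne_zero, and_false, if_false]
      linarith
  have hT₁ : l2Norm (k + 1) T₁ ≤ S / (1 - b) * H := by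
    rw [hH, l2Norm_const_mul _ (by positivity)]
    gcongr
    exact l2Norm_geometric_le _ hlam0 hlam1 (hh0 0)
  have hT₂ : l2Norm (k + 1) T₂ ≤ Real.sqrt 2 * S * R := by
    rw [l2Norm_const_mul _ hS, mul_comm (Real.sqrt 2), mul_assoc]
    refine mul_le_mul_of_nonneg_left (le_of_sq_le_sq ?_ (by positivity)) hS
    have h1 := pow_le_pow_left₀ (l2Norm_nonneg _ _) hGR 2
    have h2 := pow_le_pow_left₀ (l2Norm_nonneg _ _) ((l2Norm_le_succ _ _).trans hGR) 2
    rw [l2Norm_succ_sq] at h1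
    rw [l2Norm_succ_sq, mul_pow, Real.sq_sqrt zero_le_two]
    have h3 : ∀ l : ℕ, max (l + 1) 1 = l + 1 := by omega
    simp only [h3, Nat.zero_max]
    nlinarith [sq_nonneg (l2Norm k fun l => G (l + 1 + 1))]
  have hT₃ : l2Norm (k + 1) T₃ ≤ lam * r * (9 / 8 / (1 - b)) * R := by
    rw [l2Norm_const_mul _ (by positivity)]
    gcongr
  have hc₂n : S * l2Norm (k + 1) c₂ ≤ p * R := by
    have h1 := l2Norm_linRec_le hlam0 hlam1 (fun l => lam * L * U l) k
    rw [l2Norm_const_mul _ (by positivity)] at h1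
    calc S * l2Norm (k + 1) c₂ ≤ S * (lam * L * R / (1 - lam)) := by
          refine mul_le_mul_of_nonneg_left (h1.trans ?_) hS
          have := (l2Norm_le_succ k U).trans hUR
          gcongr
      _ = p * R := by rw [hp]; ring
  have hT₄ : l2Norm (k + 1) T₄ ≤ 2 * p * R := by
    refine le_of_sq_le_sq ?_ (by positivity)
    have h1 : (b / (1 - b)) ^ 2 ≤ 3 * p ^ 2 := by
      have h2 : b / (1 - b) ≤ 37 / 21.5 * (lam * L * S) := by
        rw [div_le_iff₀ hb1]
        have : 21.5 / 40 ≤ 1 - b := by rw [hb]; linarith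
        nlinarith
      have h3 := pow_le_pow_left₀ (by positivity) (h2.trans
        (mul_le_mul_of_nonneg_left hPp (by norm_num))) 2
      nlinarith [sq_nonneg p]
    have h2 : U 0 ^ 2 ≤ R ^ 2 := by
      have h3 := pow_le_pow_left₀ (l2Norm_nonneg _ _) hUR 2
      rw [l2Norm_succ_sq] at h3
      nlinarith [sq_nonneg (l2Norm k fun l => U (l + 1))]
    have h3 := pow_le_pow_left₀ (mul_nonneg hS (l2Norm_nonneg _ _)) hc₂n 2
    have h4 : l2Norm k (fun l => T₄ (l + 1)) ^ 2 ≤ (p * R) ^ 2 := by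
      refine (le_of_eq_of_le (b := S ^ 2 * l2Norm k (fun l => c₂ (l + 1)) ^ 2) ?_ ?_).trans h3
      · simp only [T₄, Nat.add_eq_zero_iff, one_ne_zero, and_false, if_false]
        rw [l2Norm_const_mul _ hS, mul_pow]
      · rw [mul_pow, l2Norm_succ_sq k c₂]
        exact mul_le_mul_of_nonneg_left (le_add_of_nonneg_right (sq_nonneg _)) (sq_nonneg S)
    rw [l2Norm_succ_sq]
    have h5 : T₄ 0 ^ 2 ≤ 3 * p ^ 2 * R ^ 2 := by
      simp only [T₄, if_true, mul_pow]
      gcongr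
    linarith
  have hT₅ : l2Norm (k + 1) T₅ ≤ b / (1 - b) * ((1 + lam) * e 0) := by
    have := he0 0
    refine le_of_sq_le_sq ?_ (by positivity)
    rw [l2Norm_succ_sq]
    simp [T₅, l2Norm]
  have hT₆ : l2Norm (k + 1) T₆ ≤ p * ((1 + lam) * l2Norm (k + 1) e + l2Norm (k + 1) φ) := by
    have h1 := l2Norm_linRec_le hlam0 hlam1 (fun l => lam * L * ((1 + lam) * e l + φ l)) k
    rw [l2Norm_const_mul _ (by positivity)] at h1
    have h2 := l2Norm_add_le k (fun l => (1 + lam) * e l) φ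
    rw [l2Norm_const_mul _ (by positivity)] at h2
    have h3 := l2Norm_le_succ k e
    have h4 := l2Norm_le_succ k φ
    rw [l2Norm_const_mul _ hS]
    calc S * l2Norm (k + 1) c₁
        ≤ S * (lam * L * ((1 + lam) * l2Norm (k + 1) e + l2Norm (k + 1) φ) / (1 - lam)) := by
          refine mul_le_mul_of_nonneg_left (h1.trans ?_) hS
          gcongr
          refine h2.trans ?_
          gcongr
      _ = _ := by rw [hp]; ring
  have hsum := l2Norm_mono (k := k + 1) hφ0 hpt
  have a₁ := l2Norm_add_le (k + 1) T₁ T₂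
  have a₂ := l2Norm_add_le (k + 1) (fun l => T₁ l + T₂ l) T₃
  have a₃ := l2Norm_add_le (k + 1) (fun l => T₁ l + T₂ l + T₃ l) T₄
  have a₄ := l2Norm_add_le (k + 1) (fun l => T₁ l + T₂ l + T₃ l + T₄ l) T₅
  have a₅ := l2Norm_add_le (k + 1) (fun l => T₁ l + T₂ l + T₃ l + T₄ l + T₅ l) T₆
  linarith

set_option maxHeartbeats 800000 in
/-- Closing the feedback loop between the consensus error `X` and the forcing norm `F`. -/
lemma disagreement_le_of_forcing {lam L S r m η p b Q X Xf F R E Ef H Hs e₀ es : ℝ}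
    (hlam0 : 0 ≤ lam) (hlam1 : lam < 1) (hL : 0 ≤ L) (hS : 0 ≤ S) (hr : 0 ≤ r) (hm : 1 ≤ m)
    (hp : p = lam * L * S / (1 - lam)) (hb : b = 37 / 40 * (lam * L * S))
    (hη : η = 1 - 2 * (m * (lam * L * S * (1 + lam) / (1 - lam) ^ 2))) (hη0 : 0 < η)
    (hF0 : 0 ≤ F) (hR0 : 0 ≤ R) (hHs0 : 0 ≤ Hs) (he₀ : e₀ ≤ m * es) (hes : es ≤ E)
    (hE0 : 0 ≤ E) (hEf : Ef ≤ m * E) (hH : H ≤ m * Hs)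
    (hX : X ≤ E + F / (1 - lam)) (hXf : Xf ≤ Ef + F / (1 - lam))
    (hQ : Q = S / (1 - b) * H + Real.sqrt 2 * S * R + lam * r * (9 / 8 / (1 - b)) * R +
      2 * p * R + b / (1 - b) * ((1 + lam) * e₀))
    (hF : F ≤ Q + p * ((1 + lam) * Xf + F)) :
    η * X ≤ Real.sqrt 2 * E + 2 * (m * S / (1 - lam)) * Hs +
      (Real.sqrt 2 * ((m * S + lam * r) / (1 - lam)) + 2 * (m * S / (1 - lam)) *
        ((lam * L * (m * S) + lam * L * (1 + lam * r)) / (1 - lam))) * R := by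
  have hμ : 0 < 1 - lam := by linarith
  have hm0 : 0 ≤ m := by linarith
  set P := lam * L * S with hPdef
  have hP0 : 0 ≤ P := by positivity
  obtain ⟨σ, hσ⟩ : ∃ σ, σ = P * (1 + lam) / (1 - lam) ^ 2 := ⟨_, rfl⟩
  rw [← hσ] at hη
  have hpσ : p * (1 + lam) / (1 - lam) = σ := by rw [hp, hσ]; field_simp
  have hp0 : 0 ≤ p := by rw [hp]; positivity
  have hσ0 : 0 ≤ σ := by rw [hσ]; positivity
  have hPp : P ≤ p := by
    rw [hp, le_div_iff₀ hμ]
    nlinarith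
  have hpσ' : p ≤ σ := by
    rw [← hpσ, le_div_iff₀ hμ]
    nlinarith
  have hσm : σ ≤ m * σ := le_mul_of_one_le_left hσ0 hm
  have hσ1 : m * σ ≤ 1 / 2 := by linarith
  have hb0 : 0 ≤ b := by rw [hb]; positivity
  have hbσ : b ≤ 37 / 40 * (m * σ) := by rw [hb]; linarith
  have hb1 : 0 < 1 - b := by linarith
  have h2 : 1.414 ≤ Real.sqrt 2 := Real.le_sqrt_of_sq_le (by norm_num)
  have hFη : η * F ≤ Q + p * (1 + lam) * Ef := by
    have h1 : p * ((1 + lam) * Xf) ≤ p * (1 + lam) * Ef + σ * F := by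
      calc p * ((1 + lam) * Xf) ≤ p * ((1 + lam) * (Ef + F / (1 - lam))) := by gcongr
        _ = p * (1 + lam) * Ef + p * (1 + lam) / (1 - lam) * F := by ring
        _ = _ := by rw [hpσ]
    have h3 : (p + σ) * F ≤ 2 * (m * σ) * F := by gcongr; linarith
    rw [hη]
    linarith
  have hmain : η * X ≤ (1 - m * σ) * E + Q / (1 - lam) := by
    calc η * X ≤ η * (E + F / (1 - lam)) := by gcongr
      _ = η * E + η * F / (1 - lam) := by ring
      _ ≤ η * E + (Q + p * (1 + lam) * (m * E)) / (1 - lam) := by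
        gcongr
        exact hFη.trans (by gcongr)
      _ = η * E + p * (1 + lam) / (1 - lam) * (m * E) + Q / (1 - lam) := by ring
      _ = _ := by rw [hpσ, hη]; ring
  have hA : 9 / 8 / (1 - b) ≤ Real.sqrt 2 + 2 * P := by
    rw [div_le_iff₀ hb1, hb]
    have hP1 : P ≤ 1 / 2 := by linarith
    calc (9 / 8 : ℝ) ≤ (1.414 + 2 * P) * (1 - 37 / 40 * P) := by
          linarith [mul_nonneg hP0 (sub_nonneg.2 hP1)]
      _ ≤ _ := mul_le_mul_of_nonneg_right (by linarith) (by linarith)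
  have hQh : S / (1 - b) * H / (1 - lam) ≤ 2 * (m * S / (1 - lam)) * Hs := by
    have h3 : S / (1 - b) ≤ 2 * S := by
      rw [div_le_iff₀ hb1]
      linarith [mul_nonneg hS (show 0 ≤ 1 - 2 * b by linarith)]
    calc S / (1 - b) * H / (1 - lam) ≤ S / (1 - b) * (m * Hs) / (1 - lam) := by gcongr
      _ ≤ 2 * S * (m * Hs) / (1 - lam) := by gcongr
      _ = _ := by ring
  have hQe : b / (1 - b) * ((1 + lam) * e₀) / (1 - lam) ≤ (Real.sqrt 2 - 1 + m * σ) * E := by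
    have h3 : b / (1 - b) * ((1 + lam) * e₀) / (1 - lam) ≤
        37 / 40 * (m * σ) / (1 - b) * E := by
      calc b / (1 - b) * ((1 + lam) * e₀) / (1 - lam)
          ≤ b / (1 - b) * ((1 + lam) * (m * E)) / (1 - lam) := by
            gcongr
            exact he₀.trans (by gcongr)
        _ = 37 / 40 * (m * (P * (1 + lam) / (1 - lam))) / (1 - b) * E := by rw [hb]; ring
        _ ≤ _ := by
            gcongr
            rw [← hpσ]
            gcongr
    refine h3.trans (mul_le_mul_of_nonneg_right ?_ hE0)
    rw [div_le_iff₀ hb1]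
    have h4 : 0 ≤ m * σ := by positivity
    calc 37 / 40 * (m * σ) ≤ (0.414 + m * σ) * (1 - 37 / 40 * (m * σ)) := by
          linarith [mul_nonneg h4 (sub_nonneg.2 hσ1)]
      _ ≤ _ := mul_le_mul (by linarith) (by linarith) (by linarith) (by linarith)
  have hQR : (Real.sqrt 2 * S * R + lam * r * (9 / 8 / (1 - b)) * R + 2 * p * R) / (1 - lam) ≤
      (Real.sqrt 2 * ((m * S + lam * r) / (1 - lam)) + 2 * (m * S / (1 - lam)) *
        ((lam * L * (m * S) + lam * L * (1 + lam * r)) / (1 - lam))) * R := by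
    have h3 : Real.sqrt 2 * S + lam * r * (9 / 8 / (1 - b)) + 2 * p ≤
        Real.sqrt 2 * (m * S + lam * r) + 2 * (m * p) * (m * S + 1 + lam * r) := by
      have hSm : S ≤ m * S := le_mul_of_one_le_left hS hm
      have hpm : p ≤ m * p := le_mul_of_one_le_left hp0 hm
      have hlr : 0 ≤ lam * r := by positivity
      have h4 : lam * r * (9 / 8 / (1 - b)) ≤ lam * r * (Real.sqrt 2 + 2 * (m * p)) := by
        gcongr
        linarith
      have h5 : Real.sqrt 2 * S ≤ Real.sqrt 2 * (m * S) := by gcongr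
      have h6 : 0 ≤ 2 * (m * p) * (m * S) := by positivity
      linarith
    calc _ = (Real.sqrt 2 * S + lam * r * (9 / 8 / (1 - b)) + 2 * p) / (1 - lam) * R := by ring
      _ ≤ (Real.sqrt 2 * (m * S + lam * r) + 2 * (m * p) * (m * S + 1 + lam * r)) /
            (1 - lam) * R := by gcongr
      _ = _ := by rw [hp, hPdef]; field_simp; ring
  have hQsplit : Q / (1 - lam) = S / (1 - b) * H / (1 - lam) +
      (Real.sqrt 2 * S * R + lam * r * (9 / 8 / (1 - b)) * R + 2 * p * R) / (1 - lam) +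
      b / (1 - b) * ((1 + lam) * e₀) / (1 - lam) := by rw [hQ]; ring
  linarith

set_option maxHeartbeats 1000000 in
/-- The accumulated disagreement bound, with the constants in expanded form. -/
lemma dqn_mul_l2Norm_consensus_le {N n : ℕ} (hN : 0 < N) (hn : 0 < n)
    {f : Fin N → EuclideanSpace ℝ (Fin n) → ℝ} {L : ℝ} (hL0 : 0 ≤ L)
    (hL : ∀ i (u w : EuclideanSpace ℝ (Fin n)),
      ‖gradient (f i) u - gradient (f i) w‖ ≤ L * ‖u - w‖)
    {W : Matrix (Fin N) (Fin N) ℝ}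
    (hW1 : W *ᵥ (fun _ => (1 : ℝ)) = fun _ => 1) (h1W : (fun _ => (1 : ℝ)) ᵥ* W = fun _ => 1)
    {lam : ℝ} (hlam : lam = specNorm (W - ((1 : ℝ) / N) • Matrix.of (fun _ _ => (1 : ℝ))))
    (hlam1 : lam < 1) {γ : ℝ} (hγ : 0 < γ) {C : ℕ → Fin N → Matrix (Fin n) (Fin n) ℝ}
    (hCsymm : ∀ k i, (C k i).IsSymm) (hCpos : ∀ k i, (C k i).PosDef)
    (hCnorm : ∀ k i, specNorm (C k i) ≤ γ)
    {α : ℕ → Fin N → ℝ} (hα : ∀ k i, 0 < α k i) {x v z d : ℕ → Matrix (Fin N) (Fin n) ℝ}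
    (hx : ∀ k, x (k + 1) = W * (x k + Matrix.diagonal (α k) * z k))
    (hv0 : v 0 = gradMat f (x 0))
    (hv : ∀ k, v (k + 1) = W * (v k + gradMat f (x (k + 1)) - gradMat f (x k)))
    (hd : ∀ k i, d k i = -(C k i *ᵥ v k i)) (hz : ∀ k, z k = W * d k)
    {amax r m S η : ℝ} (hmax : ∀ k i, α k i ≤ amax) (hr : 1 ≤ r)
    (har : ∀ k, amax ≤ r * ((1 / (N : ℝ)) * ∑ j, α k j))
    (hm : m = Real.sqrt (min (n : ℝ) (N : ℝ))) (hS : S = lam ^ 2 * amax * (1 + r) * γ)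
    (hη : η = 1 - 2 * (m * (lam * L * S * (1 + lam) / (1 - lam) ^ 2))) (hη0 : 0 < η) (k : ℕ) :
    η * l2Norm (k + 1) (fun l => specNorm (x l - rowMean (x l))) ≤
      Real.sqrt 2 * (specNorm (x 0 - rowMean (x 0)) / Real.sqrt (1 - lam ^ 2)) +
      2 * (m * S / (1 - lam)) * (specNorm (v 0 - rowMean (v 0)) / Real.sqrt (1 - lam ^ 2)) +
      (Real.sqrt 2 * ((m * S + lam * r) / (1 - lam)) + 2 * (m * S / (1 - lam)) *
        ((lam * L * (m * S) + lam * L * (1 + lam * r)) / (1 - lam))) *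
      Real.sqrt (∑ l ∈ Finset.range (k + 1),
        ((specNorm (rowMean (Matrix.diagonal (α l) * z l))) ^ 2 +
         (specNorm (rowMean (gradMat f (x (l + 1))))) ^ 2)) := by
  have hlam0 : 0 ≤ lam := hlam ▸ specNorm_nonneg _
  have hμ : 0 < 1 - lam := by linarith
  have hamax : 0 ≤ amax := (hα 0 ⟨0, hN⟩).le.trans (hmax 0 _)
  have hr0 : 0 ≤ r := by linarith
  have hS0 : 0 ≤ S := by rw [hS]; positivity
  have hm1 : 1 ≤ m := by
    rw [hm, Real.one_le_sqrt]
    exact le_min (by exact_mod_cast hn) (by exact_mod_cast hN)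
  have hmean : ∀ l, rowMean (v l) = rowMean (gradMat f (x l)) := fun l => by
    induction l with
    | zero => rw [hv0]
    | succ l ih => rw [hv, rowMean_mul_of_vecMul_one h1W, rowMean_sub, rowMean_add, ih]; abel
  set xs : ℕ → ℝ := fun l => specNorm (x l - rowMean (x l)) with hxs
  set e : ℕ → ℝ := fun l => ‖x l - rowMean (x l)‖ with he
  set h : ℕ → ℝ := fun l => ‖v l - rowMean (v l)‖ with hh
  set U : ℕ → ℝ := fun l => ‖rowMean (Matrix.diagonal (α l) * z l)‖ with hU
  set G : ℕ → ℝ := fun l => ‖rowMean (gradMat f (x l))‖ with hG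
  set φ : ℕ → ℝ := fun l => lam * ‖Matrix.diagonal (α l) * z l -
    rowMean (Matrix.diagonal (α l) * z l)‖ with hφ
  have hφ0 : ∀ l, 0 ≤ φ l := fun l => mul_nonneg hlam0 (norm_nonneg _)
  have hstep : ∀ l, x (l + 1) - rowMean (x (l + 1)) =
      (W - ((1 : ℝ) / N) • Matrix.of (fun _ _ => (1 : ℝ))) * (x l - rowMean (x l)) +
      (W - ((1 : ℝ) / N) • Matrix.of (fun _ _ => (1 : ℝ))) *
        (Matrix.diagonal (α l) * z l - rowMean (Matrix.diagonal (α l) * z l)) := fun l => by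
    rw [hx, consensus_mul hN hW1 h1W, rowMean_add, ← Matrix.mul_add]
    congr 1
    abel
  have hxsrec : ∀ l, xs (l + 1) ≤ lam * xs l + φ l := fun l => by
    simp only [hxs, hφ]
    rw [hstep]
    refine (specNorm_add_le _ _).trans (add_le_add ?_ ?_)
    · rw [hlam]
      exact specNorm_mul_le _ _
    · rw [hlam]
      exact (specNorm_le_frobenius_norm _).trans (frobenius_norm_mul_le _ _)
  have herec : ∀ l, e (l + 1) ≤ lam * e l + φ l := fun l => by
    simp only [he, hφ]
    rw [hstep, hlam]
    exact (norm_add_le _ _).trans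
      (add_le_add (frobenius_norm_mul_le _ _) (frobenius_norm_mul_le _ _))
  have hdelta : ∀ l, ‖x (l + 1) - x l‖ ≤ (1 + lam) * e l + φ l + U l := fun l => by
    have h1 : x (l + 1) - x l = (x (l + 1) - rowMean (x (l + 1))) - (x l - rowMean (x l)) +
        rowMean (Matrix.diagonal (α l) * z l) := by
      have h2 : rowMean (x (l + 1)) = rowMean (x l) + rowMean (Matrix.diagonal (α l) * z l) := by
        rw [hx, rowMean_mul_of_vecMul_one h1W, rowMean_add]
      rw [h2]
      abel
    have h2 := norm_add_le ((x (l + 1) - rowMean (x (l + 1))) - (x l - rowMean (x l)))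
      (rowMean (Matrix.diagonal (α l) * z l))
    have h3 := norm_sub_le (x (l + 1) - rowMean (x (l + 1))) (x l - rowMean (x l))
    have h4 := herec l
    rw [h1]
    simp only [he, hU] at h4 ⊢
    linarith
  have hgrad : ∀ l, ‖gradMat f (x (l + 1)) - gradMat f (x l)‖ ≤
      L * ((1 + lam) * e l + φ l + U l) := fun l =>
    (gradMat_lipschitz hL0 hL _ _).trans (mul_le_mul_of_nonneg_left (hdelta l) hL0)
  have hhrec : ∀ l, h (l + 1) ≤ lam * h l + lam * L * ((1 + lam) * e l + φ l + U l) := fun l => by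
    have h1 : v (l + 1) - rowMean (v (l + 1)) =
        (W - ((1 : ℝ) / N) • Matrix.of (fun _ _ => (1 : ℝ))) *
          ((v l - rowMean (v l)) + ((gradMat f (x (l + 1)) - gradMat f (x l)) -
            rowMean (gradMat f (x (l + 1)) - gradMat f (x l)))) := by
      rw [hv, consensus_mul hN hW1 h1W, rowMean_sub, rowMean_add, rowMean_sub]
      congr 1
      abel
    calc h (l + 1) ≤ lam * ‖(v l - rowMean (v l)) + ((gradMat f (x (l + 1)) - gradMat f (x l)) -
            rowMean (gradMat f (x (l + 1)) - gradMat f (x l)))‖ := by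
          simp only [hh]
          rw [h1, hlam]
          exact frobenius_norm_mul_le _ _
      _ ≤ lam * (h l + L * ((1 + lam) * e l + φ l + U l)) := by
          refine mul_le_mul_of_nonneg_left ((norm_add_le _ _).trans (add_le_add le_rfl ?_)) hlam0
          exact (frobenius_norm_consensus_le hN _).trans (hgrad l)
      _ = _ := by ring
  have hforce : ∀ l, φ l ≤ S * (h l + G l) + lam * r * U l ∧
      φ l ≤ 9 / 8 * (lam * r * U l) + S * h l + 37 / 40 * (lam * S * G l) := fun l => by
    simp only [hφ, hh, hG, hU, hS]
    rw [← hmean]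
    exact dqn_step_dispersion_bounds hN hW1 h1W hlam hγ (hCsymm l) (hCpos l)
      (hCnorm l) (hα l) (hmax l) hr (har l) (hd l) (hz l)
  have hGi : G 0 ≤ G 1 + L * ((1 + lam) * e 0 + φ 0 + U 0) := by
    have h1 := (frobenius_norm_rowMean_le hN _).trans (hgrad 0)
    rw [rowMean_sub] at h1
    have h2 := norm_sub_le (rowMean (gradMat f (x 1)))
      (rowMean (gradMat f (x (0 + 1))) - rowMean (gradMat f (x 0)))
    rw [zero_add, sub_sub_cancel] at h2
    exact h2.trans (add_le_add le_rfl h1)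
  set R := Real.sqrt (∑ l ∈ Finset.range (k + 1),
        ((specNorm (rowMean (Matrix.diagonal (α l) * z l))) ^ 2 +
         (specNorm (rowMean (gradMat f (x (l + 1))))) ^ 2))
  have hUR : l2Norm (k + 1) U ≤ R := Real.sqrt_le_sqrt <| Finset.sum_le_sum fun l _ =>
    (pow_le_pow_left₀ (norm_nonneg _) (frobenius_norm_rowMean_le_specNorm hN _) 2).trans
      (le_add_of_nonneg_right (sq_nonneg _))
  have hGR : l2Norm (k + 1) (fun l => G (l + 1)) ≤ R :=
    Real.sqrt_le_sqrt <| Finset.sum_le_sum fun l _ =>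
      (pow_le_pow_left₀ (norm_nonneg _) (frobenius_norm_rowMean_le_specNorm hN _) 2).trans
        (le_add_of_nonneg_left (sq_nonneg _))
  have hP : lam * L * S ≤ (1 - lam) / 2 := by
    have hP0 : 0 ≤ lam * L * S := by positivity
    have h1 : lam * L * S * (1 + lam) / (1 - lam) ^ 2 ≤ 1 / 2 := by
      have h2 : 0 ≤ lam * L * S * (1 + lam) / (1 - lam) ^ 2 := by positivity
      linarith [le_mul_of_one_le_left h2 hm1]
    rw [div_le_iff₀ (by positivity)] at h1
    nlinarith
  have hsq : Real.sqrt (1 - lam ^ 2) ≤ 1 := Real.sqrt_le_one.2 (by nlinarith)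
  have hsq0 : 0 < Real.sqrt (1 - lam ^ 2) := Real.sqrt_pos.2 (by nlinarith)
  have hxs0 : ∀ l, 0 ≤ xs l := fun l => specNorm_nonneg _
  have he0 : e 0 ≤ m * xs 0 := hm ▸ frobenius_norm_le_sqrt_min _
  have hh0 : h 0 ≤ m * specNorm (v 0 - rowMean (v 0)) := hm ▸ frobenius_norm_le_sqrt_min _
  have hF := l2Norm_forcing_le hlam0 hlam1 hL0 hS0 hr0 rfl rfl hP (e := e) (h := h)
    (U := U) (G := G) (fun l => norm_nonneg _) (fun l => norm_nonneg _) (fun l => norm_nonneg _)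
    (fun l => norm_nonneg _) hφ0 hhrec
    (fun l => (hforce l).1) (hforce 0).2 hGi k rfl (Real.sqrt_nonneg _) hUR hGR
  have hX := (l2Norm_le_succ _ _).trans
    (l2Norm_le_of_contraction hlam0 hlam1 hxs0 hxsrec (k + 1))
  have hXf := (l2Norm_le_succ _ _).trans
    (l2Norm_le_of_contraction hlam0 hlam1 (a := e) (fun l => norm_nonneg _) herec (k + 1))
  refine disagreement_le_of_forcing hlam0 hlam1 hL0 hS0 hr0 hm1 rfl rfl hη hη0
    (l2Norm_nonneg (k + 1) φ) (Real.sqrt_nonneg _)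
    (div_nonneg (specNorm_nonneg _) hsq0.le) he0
    (le_div_self (hxs0 0) hsq0 hsq) (div_nonneg (hxs0 0) hsq0.le) ?_ ?_ hX hXf rfl hF
  · rw [← mul_div_assoc]
    exact div_le_div_of_nonneg_right he0 hsq0.le
  · rw [← mul_div_assoc]
    exact div_le_div_of_nonneg_right hh0 hsq0.le

lemma le_specNorm_diagonal {N : ℕ} (a : Fin N → ℝ) (i : Fin N) :
    a i ≤ specNorm (Matrix.diagonal a) := by
  refine le_of_sq_le_sq ?_ (specNorm_nonneg _)
  have h := sum_sq_mulVec_le (Matrix.diagonal a) (Pi.single i 1)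
  simpa [Matrix.mulVec_diagonal, Pi.single_apply, ite_pow] using h

end MatrixNorms

theorem dqn_accumulated_primal_disagreement_bound
    {N n : ℕ} (hN : 0 < N) (hn : 0 < n)
    (f : Fin N → EuclideanSpace ℝ (Fin n) → ℝ)
    (hdiff : ∀ i, Differentiable ℝ (f i))
    (L : ℝ)
    (hL : ∀ i (u w : EuclideanSpace ℝ (Fin n)),
      ‖gradient (f i) u - gradient (f i) w‖ ≤ L * ‖u - w‖)
    (W : Matrix (Fin N) (Fin N) ℝ)
    (hW1 : W *ᵥ (fun _ => (1 : ℝ)) = fun _ => 1)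
    (h1W : (fun _ => (1 : ℝ)) ᵥ* W = fun _ => 1)
    (lam : ℝ)
    (hlam : lam = specNorm (W - ((1 : ℝ) / N) • Matrix.of (fun _ _ => (1 : ℝ))))
    (hlam1 : lam < 1)
    (γ : ℝ) (hγ : 0 < γ)
    (C : ℕ → Fin N → Matrix (Fin n) (Fin n) ℝ)
    (hCsymm : ∀ k i, (C k i).IsSymm)
    (hCpos : ∀ k i, (C k i).PosDef)
    (hCnorm : ∀ k i, specNorm (C k i) ≤ γ)
    (α : ℕ → Fin N → ℝ) (hα : ∀ k i, 0 < α k i)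
    (x v z d : ℕ → Matrix (Fin N) (Fin n) ℝ)
    (hx : ∀ k, x (k + 1) = W * (x k + Matrix.diagonal (α k) * z k))
    (hv0 : v 0 = gradMat f (x 0))
    (hv : ∀ k, v (k + 1) = W * (v k + gradMat f (x (k + 1)) - gradMat f (x k)))
    (hd : ∀ k i, d k i = -(C k i *ᵥ v k i))
    (hz0 : z 0 = W * d 0)
    (hz : ∀ k, z (k + 1) = W * d (k + 1))
    (q : ℝ) (hq : q = γ * Real.sqrt (min (n : ℝ) (N : ℝ)))
    (αmax : ℝ)
    (hαbdd : BddAbove (Set.range fun k => specNorm (Matrix.diagonal (α k))))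
    (hαmax : αmax = ⨆ k, specNorm (Matrix.diagonal (α k)))
    (rα : ℝ)
    (hrbdd : BddAbove (Set.range fun k => 1 / ((1 / (N : ℝ)) * ∑ j, α k j)))
    (hrα : rα = αmax * ⨆ k, 1 / ((1 / (N : ℝ)) * ∑ j, α k j))
    (hstep : αmax < (1 - lam) / (lam ^ 3 * L * (1 + rα) * q))
    (ρxv ρvx ρxr ρvr εx εv η μxr μxc : ℝ)
    (hρxv : ρxv = (Real.sqrt 2 / (1 - lam)) * (lam ^ 2 * αmax * (1 + rα) * q))
    (hρvx : ρvx = (Real.sqrt 2 / (1 - lam)) * (lam * L * (1 + lam)))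
    (hρxr : ρxr = (Real.sqrt 2 / (1 - lam)) * (lam ^ 2 * αmax * (1 + rα) * q + lam * rα))
    (hρvr : ρvr = (Real.sqrt 2 / (1 - lam)) *
      (lam ^ 3 * L * αmax * (1 + rα) * q + lam * L * (1 + lam * rα)))
    (hεx : εx = specNorm (x 0 - rowMean (x 0)) * Real.sqrt (2 / (1 - lam ^ 2)))
    (hεv : εv = specNorm (v 0 - rowMean (v 0)) * Real.sqrt (2 / (1 - lam ^ 2)))
    (hη : η = 1 - ρvx * ρxv) (hηpos : 0 < η)
    (hμxr : μxr = (ρxr + ρxv * ρvr) / η)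
    (hμxc : μxc = (ρxv * εv + εx) / η) :
    ∀ k, Real.sqrt (∑ l ∈ Finset.range (k + 1), (specNorm (x l - rowMean (x l))) ^ 2) ≤
      μxr * Real.sqrt (∑ l ∈ Finset.range (k + 1),
        ((specNorm (rowMean (Matrix.diagonal (α l) * z l))) ^ 2 +
         (specNorm (rowMean (gradMat f (x (l + 1))))) ^ 2)) + μxc := by
  intro k
  have hlam0 : 0 ≤ lam := hlam ▸ specNorm_nonneg _
  have hμ : 0 < 1 - lam := by linarith
  have hL0 : 0 ≤ L := by
    have h := (norm_nonneg _).trans (hL ⟨0, hN⟩ (EuclideanSpace.single ⟨0, hn⟩ 1) 0)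
    simpa using h
  have hmax : ∀ k i, α k i ≤ αmax := fun k i =>
    (le_specNorm_diagonal (α k) i).trans (hαmax ▸ le_ciSup hαbdd k)
  have hN' : (0 : ℝ) < N := by exact_mod_cast hN
  have hamax : 0 ≤ αmax := (hα 0 ⟨0, hN⟩).le.trans (hmax 0 _)
  have hs0 : ∀ k, 0 < (1 / (N : ℝ)) * ∑ j, α k j := fun k => by
    have : Nonempty (Fin N) := ⟨⟨0, hN⟩⟩
    have := Finset.sum_pos (fun j _ => hα k j) (Finset.univ_nonempty (α := Fin N))
    positivity
  have har : ∀ k, αmax ≤ rα * ((1 / (N : ℝ)) * ∑ j, α k j) := fun k => by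
    have h := le_ciSup hrbdd k
    simp only [div_le_iff₀ (hs0 k)] at h
    rw [hrα, mul_assoc]
    exact le_mul_of_one_le_right hamax h
  have hr : 1 ≤ rα := by
    have h1 : (1 / (N : ℝ)) * ∑ j, α 0 j ≤ αmax := by
      rw [one_div, inv_mul_le_iff₀ hN']
      simpa using Finset.sum_le_sum fun j (_ : j ∈ Finset.univ) => hmax 0 j
    exact le_of_mul_le_mul_right (by linarith [har 0]) (hs0 0)
  have h2 : Real.sqrt 2 * Real.sqrt 2 = 2 := Real.mul_self_sqrt zero_le_two
  have hη' : η = 1 - 2 * (Real.sqrt (min (n : ℝ) (N : ℝ)) *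
      (lam * L * (lam ^ 2 * αmax * (1 + rα) * γ) * (1 + lam) / (1 - lam) ^ 2)) := by
    rw [hη, hρvx, hρxv, hq]
    generalize Real.sqrt 2 = w at h2 ⊢
    rw [← h2]
    field_simp
  have hmain := dqn_mul_l2Norm_consensus_le hN hn hL0 hL hW1 h1W hlam hlam1 hγ hCsymm hCpos hCnorm
    hα hx hv0 hv hd (fun l => by cases l with | zero => exact hz0 | succ l => exact hz l)
    hmax hr har rfl rfl hη' hηpos k
  rw [hμxr, hμxc, div_mul_eq_mul_div, ← add_div, le_div_iff₀ hηpos, mul_comm _ η]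
  refine hmain.trans_eq ?_
  rw [hρxr, hρxv, hρvr, hεv, hεx, hq, Real.sqrt_div zero_le_two]
  generalize Real.sqrt (∑ l ∈ Finset.range (k + 1), _) = R
  generalize Real.sqrt (1 - lam ^ 2) = t
  simp only [div_eq_mul_inv]
  generalize (1 - lam)⁻¹ = i
  generalize Real.sqrt 2 = w at h2 ⊢
  rw [← h2]
  ring
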